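/- Almgren monotonicity: for w harmonic and not identically zero in B_1 ⊂ ℝ^n, the frequency N(r) = r ∫_{B_r} |Dw|^2 dx / ∫_{∂B_r} w^2 dσ is nondecreasing on (0,1). -/

import Mathlib

open MeasureTheory EuclideanSpace Metric

/-- The Laplacian `Δw(x) = ∑ᵢ ∂ᵢᵢ w(x)`. -/
noncomputable def lap {n : ℕ} (w : EuclideanSpace ℝ (Fin n) → ℝ)
    (x : EuclideanSpace ℝ (Fin n)) : ℝ :=
  ∑ i, fderiv ℝ (fun y => fderiv ℝ w y (EuclideanSpace.single i 1)) x
    (EuclideanSpace.single i 1)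

section Uniqueness

variable {X : Type*} [MetricSpace X] [CompactSpace X] [MeasurableSpace X] [BorelSpace X]

theorem integrable_of_continuous_of_compactSpace {μ : Measure X} [IsFiniteMeasure μ] {f : X → ℝ}
    (hf : Continuous f) : Integrable f μ :=
  hf.integrable_of_hasCompactSupport (HasCompactSupport.of_compactSpace f)

/-- Two finite measures on a compact metric space for which the measure of a ball depends only on
its radius are proportional (tested here on continuous functions). -/
theorem measureReal_mul_integral_eq_of_uniform (μ ν : Measure X) [IsFiniteMeasure μ]
    [IsFiniteMeasure ν] [ν.IsOpenPosMeasure]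
    (hμ : ∀ x y δ, μ (closedBall x δ) = μ (closedBall y δ))
    (hν : ∀ x y δ, ν (closedBall x δ) = ν (closedBall y δ)) {f : X → ℝ} (hf : Continuous f) :
    ν.real Set.univ * ∫ x, f x ∂μ = μ.real Set.univ * ∫ x, f x ∂ν := by
  rcases isEmpty_or_nonempty X with hX | ⟨⟨x₀⟩⟩
  · simp [Measure.eq_zero_of_isEmpty]
  set N := ν.real Set.univ
  set M := μ.real Set.univ
  have key : ∀ ε > 0, |N * ∫ x, f x ∂μ - M * ∫ x, f x ∂ν| ≤ ε * (M * N) := by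
    intro ε hε
    obtain ⟨δ, hδ, hfδ⟩ := Metric.uniformContinuous_iff.1
      (CompactSpace.uniformContinuous_of_continuous hf) ε hε
    let S : Set (X × X) := {p | dist p.1 p.2 ≤ δ / 2}
    have hS : MeasurableSet S :=
      (isClosed_le (continuous_fst.dist continuous_snd) continuous_const).measurableSet
    set g := μ.real (closedBall x₀ (δ / 2))
    set h := ν.real (closedBall x₀ (δ / 2))
    have hh : 0 < h := by
      refine ENNReal.toReal_pos ?_ (measure_ne_top _ _)
      exact (measure_closedBall_pos _ _ (by positivity)).ne'
    have i1 : ∀ u : X → ℝ, Continuous u →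
        Integrable (S.indicator (fun p => u p.1)) (μ.prod ν) := fun u hu =>
      (integrable_of_continuous_of_compactSpace (hu.comp continuous_fst)).indicator hS
    have i2 : ∀ u : X → ℝ, Continuous u →
        Integrable (S.indicator (fun p => u p.2)) (μ.prod ν) := fun u hu =>
      (integrable_of_continuous_of_compactSpace (hu.comp continuous_snd)).indicator hS
    have h1 : ∀ u : X → ℝ, Continuous u →
        ∫ p, S.indicator (fun p => u p.1) p ∂(μ.prod ν) = h * ∫ x, u x ∂μ := by
      intro u hu
      rw [integral_prod _ (i1 u hu), ← integral_const_mul]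
      congr 1 with x
      have : (fun y => S.indicator (fun p => u p.1) (x, y)) =
          (closedBall x (δ / 2)).indicator (fun _ => u x) := by
        ext y
        by_cases hxy : dist x y ≤ δ / 2 <;> simp [S, Set.indicator, hxy, dist_comm y x]
      rw [this, integral_indicator measurableSet_closedBall]
      simp [h, measureReal_def, hν x x₀]
    have h2 : ∀ u : X → ℝ, Continuous u →
        ∫ p, S.indicator (fun p => u p.2) p ∂(μ.prod ν) = g * ∫ x, u x ∂ν := by
      intro u hu
      rw [integral_prod_symm _ (i2 u hu), ← integral_const_mul]
      congr 1 with y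
      have : (fun x => S.indicator (fun p => u p.2) (x, y)) =
          (closedBall y (δ / 2)).indicator (fun _ => u y) := by
        ext x
        by_cases hxy : dist x y ≤ δ / 2 <;> simp [S, Set.indicator, hxy]
      rw [this, integral_indicator measurableSet_closedBall]
      simp [g, measureReal_def, hμ y x₀]
    have hgh : h * M = g * N := by
      have e1 := h1 (fun _ => 1) continuous_const
      have e2 := h2 (fun _ => 1) continuous_const
      rw [e1] at e2
      simpa using e2
    have hd : |h * ∫ x, f x ∂μ - g * ∫ x, f x ∂ν| ≤ ε * (h * M) := by
      have e1 := h1 (fun _ => 1) continuous_const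
      rw [← h1 f hf, ← h2 f hf, ← integral_sub (i1 f hf) (i2 f hf)]
      have e3 : ε * (h * M) = ∫ p, ε * S.indicator (fun _ => (1 : ℝ)) p ∂(μ.prod ν) := by
        rw [integral_const_mul, e1]; simp [M]
      rw [e3, ← Real.norm_eq_abs]
      refine norm_integral_le_of_norm_le (((integrable_const (1 : ℝ)).indicator hS).const_mul ε)
        (.of_forall fun p => ?_)
      by_cases hp : p ∈ S
      · simp only [hp, Set.indicator_of_mem, mul_one]
        have : dist p.1 p.2 < δ := lt_of_le_of_lt hp (by linarith)
        exact (hfδ this).le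
      · simp [hp]
    have hN : 0 ≤ N := measureReal_nonneg
    have e : N * (h * ∫ x, f x ∂μ - g * ∫ x, f x ∂ν) =
        h * (N * ∫ x, f x ∂μ - M * ∫ x, f x ∂ν) := by linear_combination (∫ x, f x ∂ν) * hgh
    have := mul_le_mul_of_nonneg_left hd hN
    rw [← abs_of_nonneg hN, ← abs_mul, abs_of_nonneg hN, e, abs_mul, abs_of_pos hh] at this
    nlinarith
  refine sub_eq_zero.1 (abs_eq_zero.1 (le_antisymm (le_of_forall_gt_imp_ge_of_dense ?_)
    (abs_nonneg _)))
  intro a ha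
  have hMN : 0 ≤ M * N := mul_nonneg measureReal_nonneg measureReal_nonneg
  refine (key (a / (M * N + 1)) (by positivity)).trans ?_
  rw [div_mul_eq_mul_div, div_le_iff₀ (by positivity)]
  nlinarith

/-- Version of `measureReal_mul_integral_eq_of_uniform` without finiteness of `μ`. -/
theorem exists_integral_eq_mul_of_uniform (μ ν : Measure X)
    [IsFiniteMeasure ν] [ν.IsOpenPosMeasure]
    (hμ : ∀ x y δ, μ (closedBall x δ) = μ (closedBall y δ))
    (hν : ∀ x y δ, ν (closedBall x δ) = ν (closedBall y δ)) :
    ∃ C : ℝ, 0 ≤ C ∧ ∀ f : X → ℝ, Continuous f → (∀ x, 0 ≤ f x) →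
      ∫ x, f x ∂μ = C * ∫ x, f x ∂ν := by
  rcases isEmpty_or_nonempty X with hX | ⟨⟨x₀⟩⟩
  · exact ⟨0, le_rfl, by simp [Measure.eq_zero_of_isEmpty]⟩
  by_cases hfin : μ Set.univ = ⊤
  · refine ⟨0, le_rfl, fun f hf hf0 => ?_⟩
    rw [zero_mul]
    by_cases hz : ∀ x, f x = 0
    · simp [hz]
    push Not at hz
    obtain ⟨x, hx⟩ := hz
    have hx : 0 < f x := lt_of_le_of_ne (hf0 x) hx.symm
    obtain ⟨δ, hδ, hball⟩ := Metric.nhds_basis_closedBall.mem_iff.1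
      (hf.continuousAt.eventually (lt_mem_nhds (half_lt_self hx)))
    have htop : μ (closedBall x δ) = ⊤ := by
      obtain ⟨t, -, htf, hcov⟩ := (isCompact_univ (X := X)).finite_cover_balls hδ
      by_contra hne
      have : μ Set.univ ≤ ∑ y ∈ htf.toFinset, μ (closedBall y δ) := by
        refine (measure_mono ?_).trans (measure_biUnion_finset_le _ _)
        refine hcov.trans ?_
        simp only [Set.Finite.mem_toFinset]
        exact Set.iUnion₂_mono fun _ _ => ball_subset_closedBall
      rw [hfin, top_le_iff, ENNReal.sum_eq_top] at this
      obtain ⟨y, -, hy⟩ := this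
      exact hne (hμ x y δ ▸ hy)
    refine integral_undef fun hint => ?_
    have h1 := hint.measure_norm_ge_lt_top (half_pos hx)
    refine h1.ne (top_le_iff.1 (htop ▸ measure_mono fun y hy => ?_))
    exact (show f x / 2 < f y from hball hy).le.trans (le_abs_self _)
  · have : IsFiniteMeasure μ := ⟨lt_top_iff_ne_top.2 hfin⟩
    have hN : 0 < ν.real Set.univ := by
      refine ENNReal.toReal_pos ?_ (measure_ne_top _ _)
      exact (isOpen_univ.measure_pos _ ⟨x₀, trivial⟩).ne'
    refine ⟨μ.real Set.univ / ν.real Set.univ, by positivity, fun f hf _ => ?_⟩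
    have := measureReal_mul_integral_eq_of_uniform μ ν hμ hν hf
    field_simp
    linarith

end Uniqueness

section SphereMeasure

variable {E : Type*} [NormedAddCommGroup E] [InnerProductSpace ℝ E]

/-- The isometry of the unit sphere induced by a linear isometry. -/
def sphereIsometry (e : E ≃ₗᵢ[ℝ] E) : sphere (0 : E) 1 ≃ᵢ sphere (0 : E) 1 where
  toFun x := ⟨e x, by simp⟩
  invFun x := ⟨e.symm x, by simp⟩
  left_inv x := by simp
  right_inv x := by simp
  isometry_toFun := fun x y => by simp [Subtype.edist_eq]

@[simp]
theorem coe_sphereIsometry (e : E ≃ₗᵢ[ℝ] E) (x : sphere (0 : E) 1) :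
    (sphereIsometry e x : E) = e x := rfl

theorem exists_sphereIsometry_eq [FiniteDimensional ℝ E] (x y : sphere (0 : E) 1) :
    ∃ e : E ≃ₗᵢ[ℝ] E, sphereIsometry e x = y :=
  ⟨(ℝ ∙ ((x : E) - y))ᗮ.reflection, Subtype.ext (Submodule.reflection_sub (by simp))⟩

variable [MeasurableSpace E] [BorelSpace E]

theorem setIntegral_sphere_hausdorffMeasure {d r : ℝ} (hd : 0 ≤ d) (hr : 0 < r) (f : E → ℝ) :
    ∫ x in sphere (0 : E) r, f x ∂μH[d] =
      r ^ d * ∫ θ : sphere (0 : E) 1, f (r • (θ : E)) ∂μH[d] := by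
  have h1 : ∫ θ : sphere (0 : E) 1, f (r • (θ : E)) ∂μH[d] =
      ∫ x in sphere (0 : E) 1, f (r • x) ∂μH[d] := by
    have h := (isometry_subtype_coe (s := sphere (0 : E) 1)).map_hausdorffMeasure (d := d) (.inl hd)
    rw [Subtype.range_coe] at h
    rw [← h, (MeasurableEmbedding.subtype_coe isClosed_sphere.measurableSet).integral_map]
  have hemb : MeasurableEmbedding (fun x : E => r • x) :=
    (Homeomorph.smulOfNeZero r hr.ne').measurableEmbedding
  have h2 := hemb.setIntegral_map (μ := μH[d]) f (sphere 0 r)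
  have h3 : Measure.map (fun x : E => r • x) μH[d] = ‖r‖₊⁻¹ ^ d • μH[d] := by
    have := map_homothety_hausdorffMeasure hd (0 : E) hr.ne'
    convert this using 2
    ext x
    simp [AffineMap.homothety_apply]
  have h4 : (fun x : E => r • x) ⁻¹' sphere 0 r = sphere 0 1 := by
    ext x
    simp [norm_smul, abs_of_pos hr, hr.ne']
  rw [h3, h4, Measure.restrict_smul, integral_smul_nnreal_measure] at h2
  rw [h1, ← h2, NNReal.smul_def, smul_eq_mul, ← mul_assoc]
  simp only [NNReal.coe_rpow, NNReal.coe_inv, coe_nnnorm, Real.norm_eq_abs, abs_of_pos hr]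
  rw [← Real.mul_rpow hr.le (by positivity), mul_inv_cancel₀ hr.ne', Real.one_rpow, one_mul]

variable [FiniteDimensional ℝ E]

theorem measure_closedBall_eq_of_measurePreserving {μ : Measure (sphere (0 : E) 1)}
    (h : ∀ e : E ≃ₗᵢ[ℝ] E, MeasurePreserving (sphereIsometry e) μ μ)
    (x y : sphere (0 : E) 1) (δ : ℝ) : μ (closedBall x δ) = μ (closedBall y δ) := by
  obtain ⟨e, rfl⟩ := exists_sphereIsometry_eq x y
  rw [← (h e).measure_preimage (s := closedBall (sphereIsometry e x) δ)
    measurableSet_closedBall.nullMeasurableSet, IsometryEquiv.preimage_closedBall]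
  simp

open scoped Pointwise in
theorem measurePreserving_sphereIsometry_toSphere (e : E ≃ₗᵢ[ℝ] E) :
    MeasurePreserving (sphereIsometry e) (volume : Measure E).toSphere
      (volume : Measure E).toSphere := by
  refine ⟨(sphereIsometry e).continuous.measurable, ?_⟩
  ext s hs
  have hs' := (sphereIsometry e).continuous.measurable hs
  rw [Measure.map_apply (sphereIsometry e).continuous.measurable hs,
    Measure.toSphere_apply' _ hs, Measure.toSphere_apply' _ hs']
  congr 1
  rw [← e.measurePreserving.measure_preimage_equiv (f := e.toMeasurableEquiv)
    (Set.Ioo (0 : ℝ) 1 • (Subtype.val '' s))]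
  congr 1
  ext x
  constructor
  · rintro ⟨t, ht, _, ⟨y, hy, rfl⟩, rfl⟩
    exact ⟨t, ht, _, ⟨_, hy, rfl⟩, by simp⟩
  · rintro ⟨t, ht, _, ⟨y, hy, rfl⟩, hx⟩
    refine ⟨t, ht, _, ⟨(sphereIsometry e).symm y, by simpa using hy, rfl⟩, e.injective ?_⟩
    have : e ((sphereIsometry e).symm y : E) = y := by
      rw [← coe_sphereIsometry, IsometryEquiv.apply_symm_apply]
    simpa [this] using hx

theorem integral_toSphere_comp_isometry (e : E ≃ₗᵢ[ℝ] E) (f : E → ℝ) :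
    ∫ θ : sphere (0 : E) 1, f (e θ) ∂(volume : Measure E).toSphere =
      ∫ θ : sphere (0 : E) 1, f θ ∂(volume : Measure E).toSphere :=
  (measurePreserving_sphereIsometry_toSphere e).integral_comp
    (sphereIsometry e).toHomeomorph.measurableEmbedding (fun θ => f θ)

/-- The Hausdorff measure on spheres is, up to a constant factor, the surface measure coming from
polar coordinates (as far as integrals of nonnegative continuous functions are concerned). -/
theorem exists_setIntegral_sphere_eq {d : ℝ} (hd : 0 ≤ d) :
    ∃ C : ℝ, 0 ≤ C ∧ ∀ r > 0, ∀ f : E → ℝ,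
      (Continuous fun θ : sphere (0 : E) 1 => f (r • (θ : E))) → (∀ x, 0 ≤ f x) →
      ∫ x in sphere (0 : E) r, f x ∂μH[d] =
        C * (r ^ d * ∫ θ : sphere (0 : E) 1, f (r • (θ : E)) ∂(volume : Measure E).toSphere) := by
  obtain ⟨C, hC, h⟩ := exists_integral_eq_mul_of_uniform (X := sphere (0 : E) 1) μH[d]
    (volume : Measure E).toSphere
    (measure_closedBall_eq_of_measurePreserving
      fun e => (sphereIsometry e).measurePreserving_hausdorffMeasure d)
    (measure_closedBall_eq_of_measurePreserving measurePreserving_sphereIsometry_toSphere)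
  refine ⟨C, hC, fun r hr f hf hf0 => ?_⟩
  rw [setIntegral_sphere_hausdorffMeasure hd hr, h _ hf fun _ => hf0 _]
  ring

/-- Integration over balls in polar coordinates. -/
theorem setIntegral_ball_eq_polar [Nontrivial E] {f : E → ℝ} (hf : Continuous f) {r : ℝ}
    (hr : 0 ≤ r) :
    ∫ x in ball (0 : E) r, f x = ∫ s in 0..r, s ^ (Module.finrank ℝ E - 1) *
      ∫ θ : sphere (0 : E) 1, f (s • (θ : E)) ∂(volume : Measure E).toSphere := by
  set m := Module.finrank ℝ E - 1
  set g : E → ℝ := (ball (0 : E) r).indicator f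
  have hg : Integrable g := by
    rw [integrable_indicator_iff measurableSet_ball]
    exact (hf.continuousOn.integrableOn_compact (isCompact_closedBall 0 r)).mono_set
      ball_subset_closedBall
  have hmp := (volume : Measure E).measurePreserving_homeomorphUnitSphereProd
  set G : sphere (0 : E) 1 × Set.Ioi (0 : ℝ) → ℝ := fun p => g ((p.2 : ℝ) • (p.1 : E))
  have hG : ∀ x : ({0}ᶜ : Set E), G (homeomorphUnitSphereProd E x) = g x := by
    intro x
    have : (x : E) ≠ 0 := x.2
    simp [G, smul_smul, this]
  have hGint : Integrable G ((volume : Measure E).toSphere.prod (Measure.volumeIoiPow m)) := by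
    rw [← hmp.integrable_comp_emb (Homeomorph.measurableEmbedding _)]
    have := (integrableOn_iff_comap_subtypeVal
      (measurableSet_singleton (0 : E)).compl).1 hg.integrableOn
    exact this.congr (.of_forall fun x => (hG x).symm)
  calc ∫ x in ball (0 : E) r, f x = ∫ x, g x := (integral_indicator measurableSet_ball).symm
    _ = ∫ x : ({0}ᶜ : Set E), g x ∂((volume : Measure E).comap (↑)) := by
      rw [integral_subtype_comap (measurableSet_singleton _).compl, restrict_compl_singleton]
    _ = ∫ p, G p ∂((volume : Measure E).toSphere.prod (Measure.volumeIoiPow m)) := by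
      rw [← hmp.integral_comp (Homeomorph.measurableEmbedding _)]
      simp_rw [hG]
    _ = ∫ s : Set.Ioi (0 : ℝ), (∫ θ : sphere (0 : E) 1, g ((s : ℝ) • (θ : E))
          ∂(volume : Measure E).toSphere) ∂(Measure.volumeIoiPow m) :=
      integral_prod_symm _ hGint
    _ = ∫ s in Set.Ioi (0 : ℝ), s ^ m * ∫ θ : sphere (0 : E) 1, g (s • (θ : E))
          ∂(volume : Measure E).toSphere := by
      simp only [Measure.volumeIoiPow, ENNReal.ofReal]
      rw [integral_withDensity_eq_integral_smul
        ((measurable_subtype_coe.pow_const _).real_toNNReal),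
        integral_subtype_comap measurableSet_Ioi fun a : ℝ ↦ Real.toNNReal (a ^ m) •
          ∫ θ : sphere (0 : E) 1, g (a • (θ : E)) ∂(volume : Measure E).toSphere]
      refine setIntegral_congr_fun measurableSet_Ioi fun x hx ↦ ?_
      simp only [NNReal.smul_def, Real.coe_toNNReal _ (pow_nonneg (le_of_lt hx) m), smul_eq_mul]
    _ = ∫ s in Set.Ioi (0 : ℝ), (Set.Iio r).indicator (fun s => s ^ m *
          ∫ θ : sphere (0 : E) 1, f (s • (θ : E)) ∂(volume : Measure E).toSphere) s := by
      refine setIntegral_congr_fun measurableSet_Ioi fun s (hs : 0 < s) ↦ ?_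
      by_cases h : s < r <;> simp [g, h, norm_smul, abs_of_pos hs, Set.indicator]
    _ = _ := by
      rw [setIntegral_indicator measurableSet_Iio, Set.Ioi_inter_Iio,
        intervalIntegral.integral_of_le hr, integral_Ioc_eq_integral_Ioo]

end SphereMeasure

section ParametricIntegral

variable {X : Type*} [MetricSpace X] [CompactSpace X] [MeasurableSpace X] [BorelSpace X]

theorem hasDerivAt_integral_of_compactSpace (μ : Measure X) [IsFiniteMeasure μ] {f f' : ℝ → X → ℝ}
    (hf : ∀ s, Continuous (f s)) (hf' : Continuous (Function.uncurry f'))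
    (h : ∀ s x, HasDerivAt (fun t => f t x) (f' s x) s) (s : ℝ) :
    HasDerivAt (fun t => ∫ x, f t x ∂μ) (∫ x, f' s x ∂μ) s := by
  obtain ⟨B, hB⟩ := ((isCompact_closedBall s 1).prod
    (isCompact_univ (X := X))).exists_bound_of_continuousOn hf'.continuousOn
  refine (hasDerivAt_integral_of_dominated_loc_of_deriv_le (bound := fun _ => B)
    (closedBall_mem_nhds s one_pos) (.of_forall fun t => (hf t).aestronglyMeasurable)
    (integrable_of_continuous_of_compactSpace (hf s))
    (hf'.comp (Continuous.prodMk_right s)).aestronglyMeasurable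
    (.of_forall fun x t ht => hB (t, x) ⟨ht, trivial⟩) (integrable_const B)
    (.of_forall fun x t _ => h t x)).2

end ParametricIntegral

section Rotation

open scoped InnerProductSpace

variable {E : Type*} [NormedAddCommGroup E] [InnerProductSpace ℝ E]

/-- Rotation by the angle `t` in the oriented plane spanned by `u` and `v`, as a linear map. -/
noncomputable def planeRotation (u v : E) (t : ℝ) : E →ₗ[ℝ] E :=
  LinearMap.id + (Real.cos t - 1) • ((innerₛₗ ℝ u).smulRight u + (innerₛₗ ℝ v).smulRight v) +
    Real.sin t • ((innerₛₗ ℝ u).smulRight v - (innerₛₗ ℝ v).smulRight u)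

theorem planeRotation_apply (u v : E) (t : ℝ) (x : E) :
    planeRotation u v t x = x + (Real.cos t - 1) • (⟪u, x⟫_ℝ • u + ⟪v, x⟫_ℝ • v) +
      Real.sin t • (⟪u, x⟫_ℝ • v - ⟪v, x⟫_ℝ • u) := by
  simp [planeRotation]

theorem norm_planeRotation {u v : E} (hu : ‖u‖ = 1) (hv : ‖v‖ = 1) (huv : ⟪u, v⟫_ℝ = 0) (t : ℝ)
    (x : E) : ‖planeRotation u v t x‖ = ‖x‖ := by
  have hvu : ⟪v, u⟫_ℝ = 0 := by rw [real_inner_comm, huv]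
  rw [← sq_eq_sq₀ (norm_nonneg _) (norm_nonneg _), ← real_inner_self_eq_norm_sq,
    ← real_inner_self_eq_norm_sq, planeRotation_apply]
  simp only [inner_add_left, inner_add_right, inner_sub_left, inner_sub_right,
    real_inner_smul_left, real_inner_smul_right, real_inner_self_eq_norm_sq u,
    real_inner_self_eq_norm_sq v, hu, hv, huv, hvu, real_inner_comm u x, real_inner_comm v x]
  linear_combination (⟪u, x⟫_ℝ ^ 2 + ⟪v, x⟫_ℝ ^ 2) * Real.sin_sq_add_cos_sq t

variable [FiniteDimensional ℝ E] [MeasurableSpace E] [BorelSpace E]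

theorem integral_toSphere_planeRotation {u v : E} (hu : ‖u‖ = 1) (hv : ‖v‖ = 1)
    (huv : ⟪u, v⟫_ℝ = 0) (t : ℝ) (f : E → ℝ) :
    ∫ θ : sphere (0 : E) 1, f (planeRotation u v t θ) ∂(volume : Measure E).toSphere =
      ∫ θ : sphere (0 : E) 1, f θ ∂(volume : Measure E).toSphere :=
  integral_toSphere_comp_isometry
    (LinearIsometry.toLinearIsometryEquiv ⟨planeRotation u v t, norm_planeRotation hu hv huv t⟩ rfl)
    f

theorem integral_toSphere_fderiv_rotation {u v : E} (hu : ‖u‖ = 1) (hv : ‖v‖ = 1)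
    (huv : ⟪u, v⟫_ℝ = 0) {g : E → ℝ} (hg : ContDiff ℝ 1 g) :
    ∫ θ : sphere (0 : E) 1, fderiv ℝ g θ (⟪u, (θ : E)⟫_ℝ • v - ⟪v, (θ : E)⟫_ℝ • u)
      ∂(volume : Measure E).toSphere = 0 := by
  have hrot : ∀ s, Continuous fun θ : sphere (0 : E) 1 => planeRotation u v s θ := fun s =>
    (planeRotation u v s).continuous_of_finiteDimensional.comp continuous_subtype_val
  have hd := hasDerivAt_integral_of_compactSpace (volume : Measure E).toSphere
    (f := fun t θ => g (planeRotation u v t θ))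
    (f' := fun t θ => fderiv ℝ g (planeRotation u v t θ)
      ((-Real.sin t) • (⟪u, (θ : E)⟫_ℝ • u + ⟪v, (θ : E)⟫_ℝ • v) +
        Real.cos t • (⟪u, (θ : E)⟫_ℝ • v - ⟪v, (θ : E)⟫_ℝ • u)))
    (fun s => hg.continuous.comp (hrot s)) ?_ ?_ 0
  · have hc : (fun t => ∫ θ : sphere (0 : E) 1, g (planeRotation u v t θ)
        ∂(volume : Measure E).toSphere) = fun _ => ∫ θ : sphere (0 : E) 1, g θ
        ∂(volume : Measure E).toSphere :=
      funext fun t => integral_toSphere_planeRotation hu hv huv t g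
    rw [hc] at hd
    simpa [planeRotation_apply] using (hasDerivAt_const _ _).unique hd |>.symm
  · have := hg.continuous_fderiv one_ne_zero
    simp only [Function.uncurry_def, planeRotation_apply]
    refine (this.comp ?_).clm_apply ?_ <;> fun_prop
  · intro s θ
    have h1 : HasDerivAt (fun t => planeRotation u v t θ)
        ((-Real.sin s) • (⟪u, (θ : E)⟫_ℝ • u + ⟪v, (θ : E)⟫_ℝ • v) +
        Real.cos s • (⟪u, (θ : E)⟫_ℝ • v - ⟪v, (θ : E)⟫_ℝ • u)) s := by
      simp only [planeRotation_apply]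
      exact ((((Real.hasDerivAt_cos s).sub_const 1).smul_const _).const_add _).add
        ((Real.hasDerivAt_sin s).smul_const _)
    exact ((hg.differentiable one_ne_zero _).hasFDerivAt).comp_hasDerivAt s h1

end Rotation

section Divergence

variable {n : ℕ}

local notation "𝔼" => EuclideanSpace ℝ (Fin n)
local notation "σ" => Measure.toSphere (volume : Measure (EuclideanSpace ℝ (Fin n)))

theorem EuclideanSpace.hasFDerivAt_coord (j : Fin n) (x : 𝔼) :
    HasFDerivAt (fun y : 𝔼 => y j) (EuclideanSpace.proj j : 𝔼 →L[ℝ] ℝ) x :=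
  (EuclideanSpace.proj j : 𝔼 →L[ℝ] ℝ).hasFDerivAt

theorem EuclideanSpace.sum_smul_single (x : 𝔼) :
    ∑ i, x i • EuclideanSpace.single i (1 : ℝ) = x := by
  ext k
  simp [Finset.sum_apply, Pi.single_apply]

theorem EuclideanSpace.clm_apply_eq_sum (L : 𝔼 →L[ℝ] ℝ) (x : 𝔼) :
    L x = ∑ i, x i * L (EuclideanSpace.single i 1) := by
  conv_lhs => rw [← EuclideanSpace.sum_smul_single x]
  simp only [map_sum, map_smul, smul_eq_mul]

theorem sum_sq_coord_sphere (θ : sphere (0 : 𝔼) 1) : ∑ i, (θ : 𝔼) i ^ 2 = 1 := by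
  have := EuclideanSpace.real_norm_sq_eq (θ : 𝔼)
  rw [← this, norm_eq_of_mem_sphere, one_pow]

/-- Integration by parts on the unit sphere. -/
theorem integral_toSphere_fderiv_tangential {g : 𝔼 → ℝ} (hg : ContDiff ℝ 1 g) (j : Fin n) :
    ∫ θ : sphere (0 : 𝔼) 1, (fderiv ℝ g θ (EuclideanSpace.single j 1) -
      (θ : 𝔼) j * fderiv ℝ g θ θ) ∂σ =
      (n - 1 : ℝ) * ∫ θ : sphere (0 : 𝔼) 1, (θ : 𝔼) j * g θ ∂σ := by
  have hcont : Continuous (fun θ : sphere (0 : 𝔼) 1 => fderiv ℝ g θ) :=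
    (hg.continuous_fderiv one_ne_zero).comp continuous_subtype_val
  have hgc : Continuous (fun θ : sphere (0 : 𝔼) 1 => g θ) :=
    hg.continuous.comp continuous_subtype_val
  let I : Fin n → sphere (0 : 𝔼) 1 → ℝ := fun i θ =>
    ((if i = j then (θ : 𝔼) i else 0) - (θ : 𝔼) j) * g θ +
      (θ : 𝔼) i * ((θ : 𝔼) i * fderiv ℝ g θ (EuclideanSpace.single j 1) -
        (θ : 𝔼) j * fderiv ℝ g θ (EuclideanSpace.single i 1))
  have hIc : ∀ i, Continuous (I i) := by
    intro i
    simp only [I]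
    split_ifs <;> fun_prop
  have hI : ∀ i, ∫ θ, I i θ ∂σ = 0 := by
    intro i
    by_cases hij : i = j
    · simp [I, hij]
    · have hgi : ContDiff ℝ 1 fun x : 𝔼 => x i * g x := by fun_prop
      rw [← integral_toSphere_fderiv_rotation (u := EuclideanSpace.single i (1 : ℝ))
        (v := EuclideanSpace.single j (1 : ℝ)) (by simp) (by simp)
        (by simp [EuclideanSpace.inner_single_left, hij]) hgi]
      congr 1 with θ
      have := (EuclideanSpace.hasFDerivAt_coord i (θ : 𝔼)).fun_mul
        (hg.differentiable one_ne_zero (θ : 𝔼)).hasFDerivAt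
      rw [this.fderiv]
      simp [I, hij, EuclideanSpace.inner_single_left]
      ring
  have hsum : ∀ θ : sphere (0 : 𝔼) 1, ∑ i, I i θ =
      (fderiv ℝ g θ (EuclideanSpace.single j 1) - (θ : 𝔼) j * fderiv ℝ g θ θ) -
        (n - 1 : ℝ) * ((θ : 𝔼) j * g θ) := by
    intro θ
    have h1 : fderiv ℝ g θ θ =
        ∑ i, (θ : 𝔼) i * fderiv ℝ g θ (EuclideanSpace.single i 1) :=
      EuclideanSpace.clm_apply_eq_sum _ _
    have h2 : ∀ i, I i θ = (if i = j then (θ : 𝔼) i * g θ else 0) - (θ : 𝔼) j * g θ +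
        (θ : 𝔼) i ^ 2 * fderiv ℝ g θ (EuclideanSpace.single j 1) -
        (θ : 𝔼) j * ((θ : 𝔼) i * fderiv ℝ g θ (EuclideanSpace.single i 1)) := by
      intro i
      simp only [I]
      split_ifs <;> ring
    simp only [h2, Finset.sum_sub_distrib, Finset.sum_add_distrib, ← Finset.sum_mul,
      ← Finset.mul_sum, ← h1, sum_sq_coord_sphere]
    simp
    ring
  have h0 : ∫ θ, ∑ i, I i θ ∂σ = 0 := by
    rw [integral_finsetSum _ fun i _ => integrable_of_continuous_of_compactSpace (hIc i)]
    simp [hI]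
  simp_rw [hsum] at h0
  rw [integral_sub, integral_const_mul] at h0
  · linarith
  all_goals
    refine integrable_of_continuous_of_compactSpace ?_
    fun_prop

theorem integral_toSphere_sum_coord_mul_const (c : Fin n → ℝ) :
    ∫ θ : sphere (0 : 𝔼) 1, ∑ j, (θ : 𝔼) j * c j ∂σ = 0 := by
  have h := integral_toSphere_comp_isometry (LinearIsometryEquiv.neg ℝ (E := 𝔼))
    (fun x => ∑ j, x j * c j)
  simp only [LinearIsometryEquiv.coe_neg, PiLp.neg_apply, neg_mul, Finset.sum_neg_distrib,
    integral_neg] at h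
  linarith

theorem continuous_integral_sphere {f : 𝔼 → ℝ} (hf : Continuous f) :
    Continuous fun s : ℝ => ∫ θ : sphere (0 : 𝔼) 1, f (s • (θ : 𝔼)) ∂σ := by
  have := continuous_parametric_integral_of_continuous (μ := σ)
    (f := fun (s : ℝ) (θ : sphere (0 : 𝔼) 1) => f (s • (θ : 𝔼)))
    (by simp only [Function.uncurry_def]; fun_prop) isCompact_univ
  simpa using this

theorem hasDerivAt_integral_sphere {g : 𝔼 → ℝ} (hg : ContDiff ℝ 1 g)
    {a : sphere (0 : 𝔼) 1 → ℝ} (ha : Continuous a) (s : ℝ) :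
    HasDerivAt (fun t : ℝ => ∫ θ : sphere (0 : 𝔼) 1, a θ * g (t • (θ : 𝔼)) ∂σ)
      (∫ θ : sphere (0 : 𝔼) 1, a θ * fderiv ℝ g (s • (θ : 𝔼)) θ ∂σ) s := by
  have hgc := hg.continuous
  have hg' := hg.continuous_fderiv one_ne_zero
  refine hasDerivAt_integral_of_compactSpace σ
    (f := fun t θ => a θ * g (t • (θ : 𝔼)))
    (f' := fun t θ => a θ * fderiv ℝ g (t • (θ : 𝔼)) θ) (fun s => by fun_prop)
    (by simp only [Function.uncurry_def]; fun_prop) (fun t θ => ?_) s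
  have h1 : HasDerivAt (fun t : ℝ => t • (θ : 𝔼)) (θ : 𝔼) t := by
    simpa using (hasDerivAt_id t).smul_const (θ : 𝔼)
  exact ((hg.differentiable one_ne_zero _).hasFDerivAt.comp_hasDerivAt t h1).const_mul _

theorem hasDerivAt_pow_mul_integral_sphere {m : ℕ} (hn : n = m + 1) {g : 𝔼 → ℝ}
    (hg : ContDiff ℝ 1 g) (j : Fin n) {r : ℝ} (hr : r ≠ 0) :
    HasDerivAt (fun s : ℝ => s ^ m * ∫ θ : sphere (0 : 𝔼) 1, (θ : 𝔼) j * g (s • (θ : 𝔼)) ∂σ)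
      (r ^ m * ∫ θ : sphere (0 : 𝔼) 1,
        fderiv ℝ g (r • (θ : 𝔼)) (EuclideanSpace.single j 1) ∂σ) r := by
  have hgc := hg.continuous
  have hg' := hg.continuous_fderiv one_ne_zero
  have h1 := hasDerivAt_integral_sphere hg (a := fun θ => (θ : 𝔼) j) (by fun_prop) r
  have h2 := integral_toSphere_fderiv_tangential (g := fun x => g (r • x)) (by fun_prop) j
  have h3 : ∀ x v : 𝔼, fderiv ℝ (fun x => g (r • x)) x v = r * fderiv ℝ g (r • x) v := by
    intro x v
    rw [fderiv_comp_smul]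
    simp
  simp only [h3] at h2
  have h4 : ∀ θ : sphere (0 : 𝔼) 1,
      r * fderiv ℝ g (r • (θ : 𝔼)) (EuclideanSpace.single j 1) -
        (θ : 𝔼) j * (r * fderiv ℝ g (r • (θ : 𝔼)) θ) =
      r * fderiv ℝ g (r • (θ : 𝔼)) (EuclideanSpace.single j 1) -
        r * ((θ : 𝔼) j * fderiv ℝ g (r • (θ : 𝔼)) θ) := fun θ => by ring
  simp only [h4] at h2
  rw [integral_sub (integrable_of_continuous_of_compactSpace (by fun_prop))
    (integrable_of_continuous_of_compactSpace (by fun_prop)), integral_const_mul,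
    integral_const_mul] at h2
  convert! (hasDerivAt_pow m r).mul h1 using 1
  subst hn
  push_cast at h2
  rcases m with _ | m
  · simp only [pow_zero, one_mul, Nat.cast_zero, zero_mul, zero_add] at h2 ⊢
    refine mul_left_cancel₀ hr ?_
    linarith
  · simp only [Nat.add_sub_cancel]
    rw [pow_succ]
    push_cast at h2 ⊢
    linear_combination (r ^ m) * h2

theorem integral_sphere_finsetSum {f : Fin n → 𝔼 → ℝ} {a : Fin n → sphere (0 : 𝔼) 1 → ℝ}
    (hf : ∀ j, Continuous (f j)) (ha : ∀ j, Continuous (a j)) (s : ℝ) :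
    ∫ θ : sphere (0 : 𝔼) 1, ∑ j, a j θ * f j (s • (θ : 𝔼)) ∂σ =
      ∑ j, ∫ θ : sphere (0 : 𝔼) 1, a j θ * f j (s • (θ : 𝔼)) ∂σ :=
  integral_finsetSum _ fun i _ => integrable_of_continuous_of_compactSpace (by fun_prop)

/-- The divergence theorem on balls, in polar coordinates and differentiated in the radius. -/
theorem hasDerivAt_pow_mul_integral_sphere_sum {m : ℕ} (hn : n = m + 1) {F : Fin n → 𝔼 → ℝ}
    (hF : ∀ j, ContDiff ℝ 1 (F j)) {r : ℝ} (hr : r ≠ 0) :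
    HasDerivAt
      (fun s : ℝ => s ^ m * ∫ θ : sphere (0 : 𝔼) 1, ∑ j, (θ : 𝔼) j * F j (s • (θ : 𝔼)) ∂σ)
      (r ^ m * ∫ θ : sphere (0 : 𝔼) 1,
        ∑ j, fderiv ℝ (F j) (r • (θ : 𝔼)) (EuclideanSpace.single j 1) ∂σ) r := by
  have hFc := fun j => (hF j).continuous
  have hF' := fun j => (hF j).continuous_fderiv one_ne_zero
  have h2 := integral_sphere_finsetSum
    (f := fun j x => fderiv ℝ (F j) x (EuclideanSpace.single j 1)) (a := fun _ _ => 1)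
    (fun j => by fun_prop) (fun j => by fun_prop) r
  simp only [one_mul] at h2
  simp only [h2, integral_sphere_finsetSum hFc (a := fun j θ => (θ : 𝔼) j)
    (fun j => by fun_prop), Finset.mul_sum]
  exact HasDerivAt.fun_sum fun j _ => hasDerivAt_pow_mul_integral_sphere hn (hF j) j hr

/-- The divergence theorem on balls, in polar coordinates. -/
theorem pow_mul_integral_sphere_eq {m : ℕ} (hn : n = m + 1) {F : Fin n → 𝔼 → ℝ}
    (hF : ∀ j, ContDiff ℝ 1 (F j)) {r : ℝ} (hr : 0 ≤ r) :
    r ^ m * ∫ θ : sphere (0 : 𝔼) 1, ∑ j, (θ : 𝔼) j * F j (r • (θ : 𝔼)) ∂σ =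
      ∫ s in 0..r, s ^ m * ∫ θ : sphere (0 : 𝔼) 1,
        ∑ j, fderiv ℝ (F j) (s • (θ : 𝔼)) (EuclideanSpace.single j 1) ∂σ := by
  have hFc := fun j => (hF j).continuous
  have hF' := fun j => (hF j).continuous_fderiv one_ne_zero
  have hcont : Continuous (fun s : ℝ => s ^ m *
      ∫ θ : sphere (0 : 𝔼) 1, ∑ j, (θ : 𝔼) j * F j (s • (θ : 𝔼)) ∂σ) := by
    simp only [integral_sphere_finsetSum hFc (a := fun j θ => (θ : 𝔼) j) (fun j => by fun_prop)]
    refine (continuous_pow m).mul (continuous_finsetSum _ fun j _ => ?_)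
    exact continuous_iff_continuousAt.2 fun s => (hasDerivAt_integral_sphere (hF j)
      (a := fun θ => (θ : 𝔼) j) (by fun_prop) s).continuousAt
  have hcont' : Continuous (fun s : ℝ => s ^ m * ∫ θ : sphere (0 : 𝔼) 1,
      ∑ j, fderiv ℝ (F j) (s • (θ : 𝔼)) (EuclideanSpace.single j 1) ∂σ) :=
    (continuous_pow m).mul (continuous_integral_sphere
      (f := fun x => ∑ j, fderiv ℝ (F j) x (EuclideanSpace.single j 1)) (by fun_prop))
  rw [intervalIntegral.integral_eq_sub_of_hasDerivAt_of_le hr hcont.continuousOn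
    (fun s hs => hasDerivAt_pow_mul_integral_sphere_sum hn hF hs.1.ne')
    (hcont'.intervalIntegrable _ _)]
  simp only [zero_smul, integral_toSphere_sum_coord_mul_const, mul_zero, sub_zero]

end Divergence

section RealAnalysis

theorem monotoneOn_mul_div_of_hasDerivAt {h A Q : ℝ → ℝ} {s : Set ℝ} (hs : Convex ℝ s)
    (hs0 : s ⊆ Set.Ioi 0) (hh : ∀ r ∈ s, HasDerivAt h (2 * A r) r)
    (hA : ∀ r ∈ s, HasDerivAt (fun r => r * A r) (2 * r * Q r) r)
    (hAQ : ∀ r ∈ s, A r ^ 2 ≤ Q r * h r) (hpos : ∀ r ∈ s, 0 < h r) :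
    MonotoneOn (fun r => r * A r / h r) s := by
  have hd : ∀ r ∈ s, HasDerivAt (fun r => r * A r / h r)
      ((2 * r * Q r * h r - r * A r * (2 * A r)) / h r ^ 2) r := fun r hr =>
    (hA r hr).div (hh r hr) (hpos r hr).ne'
  refine monotoneOn_of_deriv_nonneg hs (fun r hr => (hd r hr).continuousAt.continuousWithinAt)
    (fun r hr => (hd r (interior_subset hr)).differentiableAt.differentiableWithinAt)
    fun r hr => ?_
  have hr := interior_subset hr
  rw [(hd r hr).deriv]
  refine div_nonneg ?_ (sq_nonneg _)
  have := mul_le_mul_of_nonneg_left (hAQ r hr) (le_of_lt (hs0 hr))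
  nlinarith

/-- A quantitative unique continuation principle: if the frequency `r * A r / h r` is
nondecreasing, then `h` cannot vanish below a radius where it is positive. -/
theorem pos_of_pos_of_hasDerivAt {h A Q : ℝ → ℝ} {R : ℝ}
    (hh : ∀ r, HasDerivAt h (2 * A r) r)
    (hA : ∀ r ∈ Set.Ioo 0 R, HasDerivAt (fun r => r * A r) (2 * r * Q r) r)
    (hAQ : ∀ r, A r ^ 2 ≤ Q r * h r) (hA0 : ∀ r ∈ Set.Ioo 0 R, 0 ≤ A r) {r₀ r₁ : ℝ}
    (h0 : 0 < r₀) (h01 : r₀ ≤ r₁) (h1 : r₁ < R) (hpos : 0 < h r₁) : 0 < h r₀ := by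
  by_contra! hneg
  have hcont : Continuous h := continuous_iff_continuousAt.2 fun r => (hh r).continuousAt
  obtain ⟨a, ⟨⟨ha0, ha1⟩, ha⟩, hmax⟩ := (isCompact_Icc.inter_right
    (isClosed_le hcont continuous_const) :
      IsCompact (Set.Icc r₀ r₁ ∩ {r | h r ≤ 0})).exists_isGreatest ⟨r₀, ⟨le_rfl, h01⟩, hneg⟩
  have ha_pos : 0 < a := h0.trans_le ha0
  have hposI : ∀ r ∈ Set.Ioc a r₁, 0 < h r := by
    intro r hr
    by_contra! hr'
    exact hr.1.not_ge (hmax ⟨⟨ha0.trans hr.1.le, hr.2⟩, hr'⟩)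
  have hsub : Set.Ioc a r₁ ⊆ Set.Ioo 0 R := fun r hr => ⟨ha_pos.trans hr.1, hr.2.trans_lt h1⟩
  have hmono := monotoneOn_mul_div_of_hasDerivAt (convex_Ioc a r₁) (fun r hr => (hsub hr).1)
    (fun r _ => hh r) (fun r hr => hA r (hsub hr)) (fun r _ => hAQ r) hposI
  have ha1' : a < r₁ := lt_of_le_of_ne ha1 fun e => (e ▸ ha : h r₁ ≤ 0).not_gt hpos
  set K := r₁ * A r₁ / h r₁
  have hd : ∀ r, HasDerivAt (fun r => h r * Real.exp (-(2 * K / a) * r))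
      (2 * A r * Real.exp (-(2 * K / a) * r) +
        h r * (Real.exp (-(2 * K / a) * r) * (-(2 * K / a)))) r := fun r =>
    (hh r).mul (by simpa using ((hasDerivAt_id r).const_mul (-(2 * K / a))).exp)
  have hanti : AntitoneOn (fun r => h r * Real.exp (-(2 * K / a) * r)) (Set.Icc a r₁) := by
    refine antitoneOn_of_deriv_nonpos (convex_Icc _ _)
      (fun r _ => (hd r).continuousAt.continuousWithinAt)
      (fun r _ => (hd r).differentiableAt.differentiableWithinAt) fun r hr => ?_
    rw [interior_Icc] at hr
    have hr' : r ∈ Set.Ioc a r₁ := ⟨hr.1, hr.2.le⟩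
    have hK : r * A r / h r ≤ K := hmono hr' ⟨ha1', le_rfl⟩ hr.2.le
    rw [div_le_iff₀ (hposI r hr')] at hK
    have hAr := hA0 r (hsub hr')
    have hKa : A r ≤ K / a * h r := by
      rw [div_mul_eq_mul_div, le_div_iff₀ ha_pos]
      nlinarith [hr.1]
    rw [(hd r).deriv]
    have e : 2 * A r * Real.exp (-(2 * K / a) * r) +
        h r * (Real.exp (-(2 * K / a) * r) * (-(2 * K / a))) =
        -(2 * Real.exp (-(2 * K / a) * r) * (K / a * h r - A r)) := by ring
    rw [e]
    have := mul_nonneg (by positivity : (0 : ℝ) ≤ 2 * Real.exp (-(2 * K / a) * r))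
      (sub_nonneg.2 hKa)
    linarith
  have hle := hanti ⟨le_rfl, ha1⟩ ⟨ha1, le_rfl⟩ ha1
  have h2 : h a * Real.exp (-(2 * K / a) * a) ≤ 0 :=
    mul_nonpos_of_nonpos_of_nonneg ha (Real.exp_pos _).le
  have h3 : 0 < h r₁ * Real.exp (-(2 * K / a) * r₁) := by positivity
  exact (h3.trans_le (hle.trans h2)).false

end RealAnalysis

section Frequency

variable {n : ℕ}

local notation "𝔼" => EuclideanSpace ℝ (Fin n)
local notation "σ" => Measure.toSphere (volume : Measure (EuclideanSpace ℝ (Fin n)))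

/-- The partial derivative `∂ⱼ u`. -/
noncomputable def partialDeriv (u : 𝔼 → ℝ) (j : Fin n) (x : 𝔼) : ℝ :=
  fderiv ℝ u x (EuclideanSpace.single j 1)

/-- `∫_{∂B₁} u(rθ)² dσ(θ)`. -/
noncomputable def sphereHeight (u : 𝔼 → ℝ) (r : ℝ) : ℝ :=
  ∫ θ : sphere (0 : 𝔼) 1, u (r • (θ : 𝔼)) ^ 2 ∂σ

/-- `∫_{∂B₁} u(rθ) ∂_ν u(rθ) dσ(θ)`. -/
noncomputable def sphereFlux (u : 𝔼 → ℝ) (r : ℝ) : ℝ :=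
  ∫ θ : sphere (0 : 𝔼) 1, u (r • (θ : 𝔼)) * fderiv ℝ u (r • (θ : 𝔼)) θ ∂σ

/-- `∫_{∂B₁} (∂_ν u(rθ))² dσ(θ)`. -/
noncomputable def sphereNormalEnergy (u : 𝔼 → ℝ) (r : ℝ) : ℝ :=
  ∫ θ : sphere (0 : 𝔼) 1, fderiv ℝ u (r • (θ : 𝔼)) θ ^ 2 ∂σ

/-- `∫_{∂B₁} |Du(rθ)|² dσ(θ)`. -/
noncomputable def sphereEnergy (u : 𝔼 → ℝ) (r : ℝ) : ℝ :=
  ∫ θ : sphere (0 : 𝔼) 1, ∑ j, partialDeriv u j (r • (θ : 𝔼)) ^ 2 ∂σ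

theorem norm_gradient_sq (u : 𝔼 → ℝ) (x : 𝔼) :
    ‖gradient u x‖ ^ 2 = ∑ j, partialDeriv u j x ^ 2 := by
  rw [EuclideanSpace.real_norm_sq_eq]
  congr 1 with j
  have h : inner ℝ (gradient u x) (EuclideanSpace.single j (1 : ℝ)) = partialDeriv u j x :=
    InnerProductSpace.toDual_symm_apply
  have h' : gradient u x j = inner ℝ (gradient u x) (EuclideanSpace.single j (1 : ℝ)) := by
    simp only [EuclideanSpace.inner_single_right, one_mul, conj_trivial]
  rw [h', h]

theorem lap_eq_sum_partialDeriv (u : 𝔼 → ℝ) (x : 𝔼) :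
    lap u x = ∑ j, partialDeriv (partialDeriv u j) j x := rfl

variable {u : EuclideanSpace ℝ (Fin n) → ℝ}

theorem contDiff_partialDeriv (hu : ContDiff ℝ (⊤ : ℕ∞) u) (j : Fin n) :
    ContDiff ℝ (⊤ : ℕ∞) (partialDeriv u j) :=
  (hu.fderiv_right (m := (⊤ : ℕ∞)) le_rfl).clm_apply contDiff_const

theorem partialDeriv_comm (hu : ContDiff ℝ (⊤ : ℕ∞) u) (i j : Fin n) (x : 𝔼) :
    partialDeriv (partialDeriv u i) j x = partialDeriv (partialDeriv u j) i x := by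
  have hd : DifferentiableAt ℝ (fderiv ℝ u) x :=
    ((hu.fderiv_right (m := (⊤ : ℕ∞)) le_rfl).differentiable (by simp)) x
  have h : ∀ i j, partialDeriv (partialDeriv u i) j x =
      fderiv ℝ (fderiv ℝ u) x (EuclideanSpace.single j 1) (EuclideanSpace.single i 1) := by
    intro i j
    unfold partialDeriv
    rw [fderiv_clm_apply hd (differentiableAt_const _)]
    simp
  rw [h, h]
  exact (hu.contDiffAt.isSymmSndFDerivAt (by
    simpa using WithTop.coe_le_coe.2 (le_top : (2 : ℕ∞) ≤ ⊤))) _ _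

theorem hasDerivAt_sphereHeight (hu : ContDiff ℝ (⊤ : ℕ∞) u) (r : ℝ) :
    HasDerivAt (sphereHeight u) (2 * sphereFlux u r) r := by
  have h := hasDerivAt_integral_sphere (g := fun x => u x ^ 2) ((hu.of_le (by simp)).pow 2)
    (a := fun _ => 1) continuous_const r
  have h' : ∀ x v : 𝔼, fderiv ℝ (fun x => u x ^ 2) x v = 2 * (u x * fderiv ℝ u x v) := by
    intro x v
    rw [fderiv_fun_pow 2 (hu.differentiable (by simp) x)]
    simp
    ring
  simp only [one_mul, h', integral_const_mul] at h
  exact h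

theorem sphereFlux_sq_le (hu : ContDiff ℝ (⊤ : ℕ∞) u) (r : ℝ) :
    sphereFlux u r ^ 2 ≤ sphereNormalEnergy u r * sphereHeight u r := by
  have huc := hu.continuous
  have huc' := hu.continuous_fderiv (by simp)
  have h : ∀ t : ℝ, 0 ≤ sphereNormalEnergy u r * (t * t) + (2 * sphereFlux u r) * t +
      sphereHeight u r := by
    intro t
    have h0 : 0 ≤ ∫ θ : sphere (0 : 𝔼) 1,
        (t * fderiv ℝ u (r • (θ : 𝔼)) θ + u (r • (θ : 𝔼))) ^ 2 ∂σ :=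
      integral_nonneg fun _ => sq_nonneg _
    have e : ∀ θ : sphere (0 : 𝔼) 1,
        (t * fderiv ℝ u (r • (θ : 𝔼)) θ + u (r • (θ : 𝔼))) ^ 2 =
        t * t * fderiv ℝ u (r • (θ : 𝔼)) θ ^ 2 +
          2 * t * (u (r • (θ : 𝔼)) * fderiv ℝ u (r • (θ : 𝔼)) θ) + u (r • (θ : 𝔼)) ^ 2 :=
      fun θ => by ring
    simp only [e] at h0
    rw [integral_add, integral_add, integral_const_mul, integral_const_mul] at h0
    · unfold sphereNormalEnergy sphereFlux sphereHeight
      linarith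
    all_goals exact integrable_of_continuous_of_compactSpace (by fun_prop)
  have := discrim_le_zero h
  unfold discrim at this
  nlinarith

theorem sum_coord_mul_partialDeriv (u : 𝔼 → ℝ) (x v : 𝔼) :
    ∑ j, v j * partialDeriv u j x = fderiv ℝ u x v :=
  (EuclideanSpace.clm_apply_eq_sum _ _).symm

variable {m : ℕ} {R : ℝ}

theorem smul_mem_ball_of_mem_sphere {r : ℝ} (hr : r ∈ Set.Ico 0 R) (θ : sphere (0 : 𝔼) 1) :
    r • (θ : 𝔼) ∈ ball (0 : 𝔼) R := by
  simp [norm_smul, abs_of_nonneg hr.1, hr.2]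

theorem sum_partialDeriv_mul (hu : ContDiff ℝ (⊤ : ℕ∞) u) {x : 𝔼} (hx : lap u x = 0) :
    ∑ j, partialDeriv (fun x => u x * partialDeriv u j x) j x = ∑ j, partialDeriv u j x ^ 2 := by
  have h : ∀ j, partialDeriv (fun x => u x * partialDeriv u j x) j x =
      u x * partialDeriv (partialDeriv u j) j x + partialDeriv u j x ^ 2 := by
    intro j
    conv_lhs => unfold partialDeriv
    have := (hu.differentiable (by simp) x).hasFDerivAt.fun_mul
      ((contDiff_partialDeriv hu j).differentiable (by simp) x).hasFDerivAt
    change fderiv ℝ (fun x => u x * partialDeriv u j x) x _ = _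
    rw [this.fderiv]
    simp [partialDeriv]
    ring
  simp only [h, Finset.sum_add_distrib, ← Finset.mul_sum, ← lap_eq_sum_partialDeriv, hx]
  simp

theorem hasDerivAt_pow_mul_sphereFlux (hn : n = m + 1) (hu : ContDiff ℝ (⊤ : ℕ∞) u)
    (hlap : ∀ x ∈ ball (0 : 𝔼) R, lap u x = 0) {r : ℝ} (hr : r ∈ Set.Ioo 0 R) :
    HasDerivAt (fun r => r ^ m * sphereFlux u r) (r ^ m * sphereEnergy u r) r := by
  have h := hasDerivAt_pow_mul_integral_sphere_sum hn (F := fun j x => u x * partialDeriv u j x)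
    (fun j => (hu.mul (contDiff_partialDeriv hu j)).of_le (by simp)) hr.1.ne'
  convert! h using 1
  · ext s
    unfold sphereFlux
    congr 2 with θ
    rw [← sum_coord_mul_partialDeriv, Finset.mul_sum]
    exact Finset.sum_congr rfl fun j _ => by ring
  · unfold sphereEnergy
    congr 2 with θ
    exact (sum_partialDeriv_mul hu
      (hlap _ (smul_mem_ball_of_mem_sphere ⟨hr.1.le, hr.2⟩ θ))).symm

theorem pow_mul_sphereFlux_eq (hn : n = m + 1) (hu : ContDiff ℝ (⊤ : ℕ∞) u)
    (hlap : ∀ x ∈ ball (0 : 𝔼) R, lap u x = 0) {r : ℝ} (hr : r ∈ Set.Ico 0 R) :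
    r ^ m * sphereFlux u r = ∫ s in 0..r, s ^ m * sphereEnergy u s := by
  have h := pow_mul_integral_sphere_eq hn (F := fun j x => u x * partialDeriv u j x)
    (fun j => (hu.mul (contDiff_partialDeriv hu j)).of_le (by simp)) hr.1
  convert! h using 1
  · unfold sphereFlux
    congr 2 with θ
    rw [← sum_coord_mul_partialDeriv, Finset.mul_sum]
    exact Finset.sum_congr rfl fun j _ => by ring
  · refine intervalIntegral.integral_congr fun s hs => ?_
    rw [Set.uIcc_of_le hr.1] at hs
    unfold sphereEnergy
    congr 2 with θ
    exact (sum_partialDeriv_mul hu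
      (hlap _ (smul_mem_ball_of_mem_sphere ⟨hs.1, hs.2.trans_lt hr.2⟩ θ))).symm

/-- The vector field behind the Rellich–Pohozaev identity. -/
noncomputable def rellichField (u : 𝔼 → ℝ) (j : Fin n) (x : 𝔼) : ℝ :=
  x j * ∑ k, partialDeriv u k x ^ 2 - 2 * ((∑ k, x k * partialDeriv u k x) * partialDeriv u j x)

theorem contDiff_rellichField (hu : ContDiff ℝ (⊤ : ℕ∞) u) (j : Fin n) :
    ContDiff ℝ (⊤ : ℕ∞) (rellichField u j) := by
  have := contDiff_partialDeriv hu
  unfold rellichField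
  fun_prop

theorem sum_partialDeriv_rellichField (hu : ContDiff ℝ (⊤ : ℕ∞) u) {x : 𝔼} (hx : lap u x = 0) :
    ∑ j, partialDeriv (rellichField u j) j x = (n - 2 : ℝ) * ∑ j, partialDeriv u j x ^ 2 := by
  have hp : ∀ k, HasFDerivAt (partialDeriv u k) (fderiv ℝ (partialDeriv u k) x) x := fun k =>
    ((contDiff_partialDeriv hu k).differentiable (by simp) x).hasFDerivAt
  have h : ∀ j, partialDeriv (rellichField u j) j x =
      ∑ k, partialDeriv u k x ^ 2 +
        2 * ∑ k, x j * (partialDeriv u k x * partialDeriv (partialDeriv u k) j x) -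
        2 * partialDeriv u j x ^ 2 -
        2 * ∑ k, x k * (partialDeriv u j x * partialDeriv (partialDeriv u k) j x) -
        2 * (∑ k, x k * partialDeriv u k x) * partialDeriv (partialDeriv u j) j x := by
    intro j
    have h1 : HasFDerivAt (fun x => ∑ k, partialDeriv u k x * partialDeriv u k x) _ x :=
      HasFDerivAt.fun_sum fun k _ => (hp k).fun_mul (hp k)
    have h2 : HasFDerivAt (fun x : 𝔼 => ∑ k, x k * partialDeriv u k x) _ x :=
      HasFDerivAt.fun_sum fun k _ => (EuclideanSpace.hasFDerivAt_coord k x).fun_mul (hp k)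
    have h3 := ((EuclideanSpace.hasFDerivAt_coord j x).fun_mul h1).fun_sub
      ((h2.fun_mul (hp j)).const_mul 2)
    have h4 : partialDeriv (rellichField u j) j x =
      fderiv ℝ (rellichField u j) x (EuclideanSpace.single j 1) := rfl
    rw [h4]
    unfold rellichField
    simp only [sq]
    rw [h3.fderiv]
    have h5 : ∀ k, fderiv ℝ (partialDeriv u k) x (EuclideanSpace.single j 1) =
      partialDeriv (partialDeriv u k) j x := fun _ => rfl
    simp only [sub_apply, add_apply, smul_apply, sum_apply, h5, smul_eq_mul, mul_add,
      Finset.mul_sum, Finset.sum_add_distrib, PiLp.proj_apply, PiLp.single_apply]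
    simp only [if_true, mul_one, mul_ite, mul_zero, Finset.sum_ite_eq', Finset.mem_univ,
      ← Finset.mul_sum, mul_left_comm (partialDeriv u j x)]
    ring
  have hswap : ∑ j, ∑ k, x j * (partialDeriv u k x * partialDeriv (partialDeriv u k) j x) =
      ∑ j, ∑ k, x k * (partialDeriv u j x * partialDeriv (partialDeriv u k) j x) := by
    rw [Finset.sum_comm]
    simp only [partialDeriv_comm hu]
  simp only [h, Finset.sum_sub_distrib, Finset.sum_add_distrib, ← Finset.mul_sum,
    ← lap_eq_sum_partialDeriv, hx] at hswap ⊢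
  simp
  linear_combination 2 * hswap

theorem sum_coord_mul_rellichField (u : 𝔼 → ℝ) (r : ℝ) (θ : sphere (0 : 𝔼) 1) :
    ∑ j, (θ : 𝔼) j * rellichField u j (r • (θ : 𝔼)) =
      r * (∑ j, partialDeriv u j (r • (θ : 𝔼)) ^ 2 - 2 * fderiv ℝ u (r • (θ : 𝔼)) θ ^ 2) := by
  have h : ∀ j, (θ : 𝔼) j * rellichField u j (r • (θ : 𝔼)) =
      (θ : 𝔼) j ^ 2 * (r * ∑ k, partialDeriv u k (r • (θ : 𝔼)) ^ 2) -
        2 * r * fderiv ℝ u (r • (θ : 𝔼)) θ * ((θ : 𝔼) j * partialDeriv u j (r • (θ : 𝔼))) := by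
    intro j
    unfold rellichField
    rw [sum_coord_mul_partialDeriv, map_smul, smul_eq_mul, PiLp.smul_apply, smul_eq_mul]
    ring
  simp only [h, Finset.sum_sub_distrib, ← Finset.sum_mul, ← Finset.mul_sum, sum_sq_coord_sphere,
    sum_coord_mul_partialDeriv]
  ring

/-- The Rellich–Pohozaev identity. -/
theorem pow_mul_sphereEnergy_sub_eq (hn : n = m + 1) (hu : ContDiff ℝ (⊤ : ℕ∞) u)
    (hlap : ∀ x ∈ ball (0 : 𝔼) R, lap u x = 0) {r : ℝ} (hr : r ∈ Set.Ico 0 R) :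
    r ^ (m + 1) * (sphereEnergy u r - 2 * sphereNormalEnergy u r) =
      (m - 1 : ℝ) * (r ^ m * sphereFlux u r) := by
  have huc' := hu.continuous_fderiv (by simp)
  have hup := fun j => (contDiff_partialDeriv hu j).continuous
  have h := pow_mul_integral_sphere_eq hn (F := rellichField u)
    (fun j => (contDiff_rellichField hu j).of_le (by simp)) hr.1
  simp only [sum_coord_mul_rellichField] at h
  rw [integral_const_mul, integral_sub (integrable_of_continuous_of_compactSpace (by fun_prop))
    (integrable_of_continuous_of_compactSpace (by fun_prop)), integral_const_mul] at h
  rw [pow_mul_sphereFlux_eq hn hu hlap hr, ← intervalIntegral.integral_const_mul, pow_succ,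
    mul_assoc]
  refine h.trans (intervalIntegral.integral_congr fun s hs => ?_)
  rw [Set.uIcc_of_le hr.1] at hs
  have hdiv : ∀ θ : sphere (0 : 𝔼) 1,
      ∑ j, fderiv ℝ (rellichField u j) (s • (θ : 𝔼)) (EuclideanSpace.single j 1) =
        (m - 1 : ℝ) * ∑ j, partialDeriv u j (s • (θ : 𝔼)) ^ 2 := fun θ => by
    refine (sum_partialDeriv_rellichField hu
      (hlap _ (smul_mem_ball_of_mem_sphere ⟨hs.1, hs.2.trans_lt hr.2⟩ θ))).trans ?_
    have hn' : (n : ℝ) = m + 1 := by exact_mod_cast hn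
    rw [hn']
    ring
  simp only [hdiv, integral_const_mul, sphereEnergy]
  ring

theorem hasDerivAt_mul_sphereFlux (hn : n = m + 1) (hu : ContDiff ℝ (⊤ : ℕ∞) u)
    (hlap : ∀ x ∈ ball (0 : 𝔼) R, lap u x = 0) {r : ℝ} (hr : r ∈ Set.Ioo 0 R) :
    HasDerivAt (fun r => r * sphereFlux u r) (2 * r * sphereNormalEnergy u r) r := by
  have hr0 : r ≠ 0 := hr.1.ne'
  have h := (hasDerivAt_id r).mul
    ((hasDerivAt_pow_mul_sphereFlux hn hu hlap hr).div (hasDerivAt_pow m r) (pow_ne_zero m hr0))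
  have hR := pow_mul_sphereEnergy_sub_eq hn hu hlap ⟨hr.1.le, hr.2⟩
  refine (h.congr_deriv ?_).congr_of_eventuallyEq ?_
  · have hR' : r * (sphereEnergy u r - 2 * sphereNormalEnergy u r) = (m - 1 : ℝ) * sphereFlux u r :=
      mul_left_cancel₀ (pow_ne_zero m hr0) (by linear_combination hR)
    have hm : (m : ℝ) * r ^ (m - 1) * r = m * r ^ m := by
      rcases m with _ | m
      · simp
      · rw [Nat.add_sub_cancel, pow_succ, mul_assoc]
    have ha : r ^ m ≠ 0 := pow_ne_zero m hr0
    simp only [id, Pi.div_apply]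
    generalize (m : ℝ) * r ^ (m - 1) = b at hm ⊢
    generalize r ^ m = a at hm ha ⊢
    field_simp
    linear_combination a * hR' - sphereFlux u r * hm
  · filter_upwards [lt_mem_nhds hr.1] with s hs
    simp only [Pi.mul_apply, Pi.div_apply, id, mul_div_cancel_left₀ _ (pow_ne_zero m hs.ne')]

theorem sphereFlux_nonneg (hn : n = m + 1) (hu : ContDiff ℝ (⊤ : ℕ∞) u)
    (hlap : ∀ x ∈ ball (0 : 𝔼) R, lap u x = 0) {r : ℝ} (hr : r ∈ Set.Ioo 0 R) :
    0 ≤ sphereFlux u r := by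
  have h := pow_mul_sphereFlux_eq hn hu hlap ⟨hr.1.le, hr.2⟩
  refine nonneg_of_mul_nonneg_right (a := r ^ m) ?_ (pow_pos hr.1 m)
  rw [h]
  refine intervalIntegral.integral_nonneg hr.1.le fun s hs => mul_nonneg (pow_nonneg hs.1 m) ?_
  exact integral_nonneg fun θ => Finset.sum_nonneg fun j _ => sq_nonneg _

theorem monotoneOn_sphereHeight (hn : n = m + 1) (hu : ContDiff ℝ (⊤ : ℕ∞) u)
    (hlap : ∀ x ∈ ball (0 : 𝔼) R, lap u x = 0) : MonotoneOn (sphereHeight u) (Set.Ico 0 R) := by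
  refine monotoneOn_of_hasDerivWithinAt_nonneg (convex_Ico 0 R)
    (fun r _ => (hasDerivAt_sphereHeight hu r).continuousAt.continuousWithinAt)
    (fun r _ => (hasDerivAt_sphereHeight hu r).hasDerivWithinAt) fun r hr => ?_
  rw [interior_Ico] at hr
  exact mul_nonneg zero_le_two (sphereFlux_nonneg hn hu hlap hr)

theorem sphereHeight_norm_pos (hn : n = m + 1) (hu : Continuous u) {x : 𝔼} (hx : u x ≠ 0) :
    0 < sphereHeight u ‖x‖ := by
  obtain ⟨θ, hθ⟩ : ∃ θ : sphere (0 : 𝔼) 1, ‖x‖ • (θ : 𝔼) = x := by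
    by_cases h0 : x = 0
    · exact ⟨⟨EuclideanSpace.single ⟨0, by omega⟩ 1, by simp⟩, by simp [h0]⟩
    · exact ⟨⟨‖x‖⁻¹ • x, by simp [norm_smul, h0]⟩, by simp [smul_smul, h0]⟩
  have hc : Continuous fun θ : sphere (0 : 𝔼) 1 => u (‖x‖ • (θ : 𝔼)) ^ 2 := by fun_prop
  refine hc.integral_pos_of_hasCompactSupport_nonneg_nonzero ?_ (fun _ => sq_nonneg _)
    (x := θ) (by simpa [hθ] using hx)
  exact HasCompactSupport.of_compactSpace _

theorem sphereHeight_pos (hn : n = m + 1) (hu : ContDiff ℝ (⊤ : ℕ∞) u)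
    (hlap : ∀ x ∈ ball (0 : 𝔼) R, lap u x = 0) {x : 𝔼} (hx : x ∈ ball (0 : 𝔼) R) (hux : u x ≠ 0)
    {r : ℝ} (hr : r ∈ Set.Ioo 0 R) : 0 < sphereHeight u r := by
  have hpos := sphereHeight_norm_pos hn hu.continuous hux
  rw [mem_ball_zero_iff] at hx
  rcases le_total ‖x‖ r with h | h
  · exact hpos.trans_le (monotoneOn_sphereHeight hn hu hlap ⟨norm_nonneg x, hx⟩ ⟨hr.1.le, hr.2⟩ h)
  · exact pos_of_pos_of_hasDerivAt (hasDerivAt_sphereHeight hu)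
      (fun r hr => hasDerivAt_mul_sphereFlux hn hu hlap hr) (sphereFlux_sq_le hu)
      (fun r hr => sphereFlux_nonneg hn hu hlap hr) hr.1 h hx hpos

/-- Monotonicity of the frequency, in polar coordinates. -/
theorem monotoneOn_frequency (hn : n = m + 1) (hu : ContDiff ℝ (⊤ : ℕ∞) u)
    (hlap : ∀ x ∈ ball (0 : 𝔼) R, lap u x = 0) {x : 𝔼} (hx : x ∈ ball (0 : 𝔼) R) (hux : u x ≠ 0) :
    MonotoneOn (fun r => r * sphereFlux u r / sphereHeight u r) (Set.Ioo 0 R) :=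
  monotoneOn_mul_div_of_hasDerivAt (convex_Ioo 0 R) (fun _ hr => hr.1)
    (fun r _ => hasDerivAt_sphereHeight hu r)
    (fun _ hr => hasDerivAt_mul_sphereFlux hn hu hlap hr) (fun r _ => sphereFlux_sq_le hu r)
    (fun _ hr => sphereHeight_pos hn hu hlap hx hux hr)

end Frequency

section Localization

theorem exists_contDiff_eqOn_ball {E : Type*} [NormedAddCommGroup E] [InnerProductSpace ℝ E]
    [FiniteDimensional ℝ E] {w : E → ℝ} {R S : ℝ} (hR : 0 < R) (hRS : R < S)
    (hw : ContDiffOn ℝ (⊤ : ℕ∞) w (ball 0 S)) :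
    ∃ u : E → ℝ, ContDiff ℝ (⊤ : ℕ∞) u ∧ Set.EqOn u w (ball 0 R) := by
  let f : ContDiffBump (0 : E) := ⟨R, (R + S) / 2, hR, by linarith⟩
  refine ⟨fun x => f x * w x, contDiff_iff_contDiffAt.2 fun x => ?_, fun x hx => ?_⟩
  · by_cases hx : x ∈ ball (0 : E) S
    · exact f.contDiff.contDiffAt.mul (hw.contDiffAt (isOpen_ball.mem_nhds hx))
    · have hx' : x ∉ tsupport f := by
        rw [f.tsupport_eq]
        intro h
        have h' : dist x 0 ≤ (R + S) / 2 := h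
        exact hx (mem_ball.2 (by linarith))
      refine (contDiffAt_const (c := (0 : ℝ))).congr_of_eventuallyEq ?_
      filter_upwards [notMem_tsupport_iff_eventuallyEq.1 hx'] with y hy
      simp [hy]
  · simp only [f.one_of_mem_closedBall (ball_subset_closedBall hx), one_mul]

variable {n : ℕ} {u w : EuclideanSpace ℝ (Fin n) → ℝ} {x : EuclideanSpace ℝ (Fin n)}

theorem lap_congr_of_eventuallyEq (h : u =ᶠ[nhds x] w) : lap u x = lap w x :=
  Finset.sum_congr rfl fun i _ => by
    have h' : (fun y => fderiv ℝ u y (EuclideanSpace.single i 1)) =ᶠ[nhds x]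
        fun y => fderiv ℝ w y (EuclideanSpace.single i 1) := by
      filter_upwards [h.fderiv (𝕜 := ℝ)] with y hy
      rw [hy]
    rw [h'.fderiv_eq]

theorem gradient_congr_of_eventuallyEq (h : u =ᶠ[nhds x] w) : gradient u x = gradient w x := by
  unfold gradient
  rw [h.fderiv_eq]

theorem setIntegral_norm_gradient_sq {m : ℕ} {R : ℝ} (hn : n = m + 1)
    (hu : ContDiff ℝ (⊤ : ℕ∞) u)
    (hlap : ∀ x ∈ ball (0 : EuclideanSpace ℝ (Fin n)) R, lap u x = 0) {r : ℝ}
    (hr : r ∈ Set.Ioo 0 R) :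
    ∫ x in ball (0 : EuclideanSpace ℝ (Fin n)) r, ‖gradient u x‖ ^ 2 = r ^ m * sphereFlux u r := by
  have : NeZero n := ⟨by omega⟩
  have hup := fun j => (contDiff_partialDeriv hu j).continuous
  simp only [norm_gradient_sq]
  rw [setIntegral_ball_eq_polar (by fun_prop) hr.1.le,
    pow_mul_sphereFlux_eq hn hu hlap ⟨hr.1.le, hr.2⟩]
  simp only [finrank_euclideanSpace_fin, hn, Nat.add_sub_cancel, sphereEnergy]

end Localization

/-- Almgren monotonicity: for `w` harmonic and not identically zero in `B₁ ⊂ ℝⁿ`,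
the frequency `N(r) = r ∫_{B_r}|Dw|² / ∫_{∂B_r} w² dσ` is nondecreasing on `(0,1)`. -/
theorem stmt5 (n : ℕ) (w : EuclideanSpace ℝ (Fin n) → ℝ)
    (hw : ContDiffOn ℝ (⊤ : ℕ∞) w (ball (0 : EuclideanSpace ℝ (Fin n)) 1))
    (hharm : ∀ x ∈ ball (0 : EuclideanSpace ℝ (Fin n)) 1, lap w x = 0)
    (hnz : ¬ ∀ x ∈ ball (0 : EuclideanSpace ℝ (Fin n)) 1, w x = 0) :
    MonotoneOn
      (fun r : ℝ =>
        (r * ∫ x in ball (0 : EuclideanSpace ℝ (Fin n)) r, ‖gradient w x‖ ^ 2) /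
          ∫ x in sphere (0 : EuclideanSpace ℝ (Fin n)) r, (w x) ^ 2 ∂μH[(n : ℝ) - 1])
      (Set.Ioo 0 1) := by
  intro r₁ hr₁ r₂ hr₂ hr
  rcases n with _ | m
  · have h0 : ∀ x, gradient w x = 0 := fun x => Subsingleton.elim _ _
    simp [h0]
  push Not at hnz
  obtain ⟨x₀, hx₀, hwx₀⟩ := hnz
  obtain ⟨R, hR, hR1⟩ := exists_between (max_lt hr₂.2 (mem_ball_zero_iff.1 hx₀))
  rw [max_lt_iff] at hR
  obtain ⟨u, hu, huw⟩ := exists_contDiff_eqOn_ball (hr₂.1.trans hR.1) hR1 hw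
  have hloc : ∀ x ∈ ball (0 : EuclideanSpace ℝ (Fin (m + 1))) R, u =ᶠ[nhds x] w := fun x hx =>
    huw.eventuallyEq_of_mem (isOpen_ball.mem_nhds hx)
  have hlap : ∀ x ∈ ball (0 : EuclideanSpace ℝ (Fin (m + 1))) R, lap u x = 0 := fun x hx =>
    (lap_congr_of_eventuallyEq (hloc x hx)).trans (hharm x (ball_subset_ball hR1.le hx))
  have hx₀R : x₀ ∈ ball (0 : EuclideanSpace ℝ (Fin (m + 1))) R := mem_ball_zero_iff.2 hR.2
  obtain ⟨C, hC, hsphere⟩ := exists_setIntegral_sphere_eq (E := EuclideanSpace ℝ (Fin (m + 1)))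
    (d := ((m + 1 : ℕ) : ℝ) - 1) (by simp)
  have hfreq : ∀ r ∈ Set.Ioo 0 R,
      (r * ∫ x in ball (0 : EuclideanSpace ℝ (Fin (m + 1))) r, ‖gradient w x‖ ^ 2) /
        ∫ x in sphere (0 : EuclideanSpace ℝ (Fin (m + 1))) r, (w x) ^ 2
          ∂μH[((m + 1 : ℕ) : ℝ) - 1] =
      C⁻¹ * (r * sphereFlux u r / sphereHeight u r) := by
    intro r hr
    have hnum : ∫ x in ball (0 : EuclideanSpace ℝ (Fin (m + 1))) r, ‖gradient w x‖ ^ 2 =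
        r ^ m * sphereFlux u r := by
      rw [← setIntegral_norm_gradient_sq rfl hu hlap hr]
      refine setIntegral_congr_fun measurableSet_ball fun x hx => ?_
      simp only [gradient_congr_of_eventuallyEq (hloc x (ball_subset_ball hr.2.le hx))]
    have hden : ∫ x in sphere (0 : EuclideanSpace ℝ (Fin (m + 1))) r, (w x) ^ 2
        ∂μH[((m + 1 : ℕ) : ℝ) - 1] = C * (r ^ m * sphereHeight u r) := by
      have huc := hu.continuous
      have h := hsphere r hr.1 (fun x => u x ^ 2) (by fun_prop) fun x => sq_nonneg _
      rw [show ((m + 1 : ℕ) : ℝ) - 1 = m by simp, Real.rpow_natCast] at h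
      rw [show ((m + 1 : ℕ) : ℝ) - 1 = m by simp, sphereHeight, ← h]
      refine setIntegral_congr_fun isClosed_sphere.measurableSet fun x hx => ?_
      have hx' : x ∈ ball (0 : EuclideanSpace ℝ (Fin (m + 1))) R :=
        mem_ball.2 ((mem_sphere.1 hx).trans_lt hr.2)
      simp only [huw hx']
    have hrm : r ^ m ≠ 0 := pow_ne_zero m hr.1.ne'
    rw [hnum, hden, mul_left_comm r, mul_left_comm C, mul_div_mul_left _ _ hrm, div_mul_eq_div_div,
      div_right_comm, div_eq_inv_mul _ C]
  dsimp only
  have hr₁R : r₁ ∈ Set.Ioo 0 R := ⟨hr₁.1, hr.trans_lt hR.1⟩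
  have hr₂R : r₂ ∈ Set.Ioo 0 R := ⟨hr₂.1, hR.1⟩
  rw [hfreq r₁ hr₁R, hfreq r₂ hr₂R]
  exact mul_le_mul_of_nonneg_left
    (monotoneOn_frequency rfl hu hlap hx₀R (by rwa [huw hx₀R]) hr₁R hr₂R hr) (inv_nonneg.2 hC)
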